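/- arXiv:2201.02400 — 5 statements merged into one kernel-verified Lean document; each statement's English description precedes it below -/
import Mathlib

section
/- For all real β > 0 and p > 0, the function s ↦ s·(exp(β·s^p) − 1) is convex on the interval [0, ∞). -/
/-- The derivative of `s ↦ s·(exp(β s^p) − 1)` at a positive point. -/
theorem hasDerivAt_mul_exp_rpow_sub_one (β p : ℝ) {s : ℝ} (hs : 0 < s) :
    HasDerivAt (fun s : ℝ => s * (Real.exp (β * s ^ p) - 1))
      (Real.exp (β * s ^ p) * (1 + p * (β * s ^ p)) - 1) s := by
  have h := (hasDerivAt_id s).mul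
    ((((Real.hasDerivAt_rpow_const (p := p) (Or.inl hs.ne')).const_mul β).exp).sub_const 1)
  refine h.congr_deriv ?_
  rw [Real.rpow_sub_one hs.ne']
  simp only [id_eq]
  field_simp
  ring

/-- The type-II nonlinearity `s ↦ s·(exp(β s^p) − 1)` is convex on `[0, ∞)`
for all `β, p > 0`. -/
theorem type_II_convexOn (β p : ℝ) (hβ : 0 < β) (hp : 0 < p) :
    ConvexOn ℝ (Set.Ici (0 : ℝ))
      (fun s : ℝ => s * (Real.exp (β * s ^ (p : ℝ)) - 1)) := by
  refine MonotoneOn.convexOn_of_deriv (convex_Ici 0) ?_ ?_ ?_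
  · have := Real.continuous_rpow_const hp.le
    exact Continuous.continuousOn (by fun_prop)
  · rw [interior_Ici]
    exact fun s hs =>
      (hasDerivAt_mul_exp_rpow_sub_one β p hs).differentiableAt.differentiableWithinAt
  · rw [interior_Ici]
    intro x hx y hy hxy
    rw [(hasDerivAt_mul_exp_rpow_sub_one β p hx).deriv,
      (hasDerivAt_mul_exp_rpow_sub_one β p hy).deriv]
    have hx0 : 0 ≤ x := le_of_lt hx
    have hpow : x ^ p ≤ y ^ p := Real.rpow_le_rpow hx0 hxy hp.le
    gcongr
end

section
/- Let p, β, μ, T > 0 be real numbers and let Φ : ℝ → ℝ be differentiable on [0, T] with Φ(t) > 0 for all t ∈ [0, T], and suppose that Φ'(t) ≥ exp(μt)·Φ(t)·(exp(β·Φ(t)^p) − 1) for all t ∈ [0, T]. Then for every natural number k ≥ 1 one has (p·β^k/(k−1)!)·((exp(μT) − 1)/μ)·Φ(0)^{pk} ≤ 1. -/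
theorem Real.pow_div_factorial_le_exp_sub_one {x : ℝ} (hx : 0 ≤ x) {k : ℕ} (hk : 1 ≤ k) :
    x ^ k / (Nat.factorial k : ℝ) ≤ Real.exp x - 1 := by
  have h := Real.sum_le_exp_of_nonneg hx (k + 1)
  rw [Finset.sum_range_succ] at h
  have h0 : x ^ 0 / (Nat.factorial 0 : ℝ) ≤ ∑ i ∈ Finset.range k, x ^ i / (Nat.factorial i : ℝ) :=
    Finset.single_le_sum (f := fun i => x ^ i / (Nat.factorial i : ℝ))
      (fun i _ => by positivity) (Finset.mem_range.2 hk)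
  simp only [pow_zero, Nat.factorial_zero, Nat.cast_one, div_one] at h0
  linarith

/-- A positive solution of `Φ' ≥ c·e^{μt}·Φ^{1+q}` on `[0,T]` satisfies
`q·c·((e^{μT} − 1)/μ)·Φ(0)^q ≤ 1`. -/
theorem mul_rpow_le_one_of_exp_mul_rpow_le_deriv {c q μ T : ℝ} (hq : 0 < q) (hμ : 0 < μ)
    (hT : 0 < T) {Φ Φ' : ℝ → ℝ}
    (hderiv : ∀ t ∈ Set.Icc (0 : ℝ) T, HasDerivAt Φ (Φ' t) t)
    (hpos : ∀ t ∈ Set.Icc (0 : ℝ) T, 0 < Φ t)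
    (hineq : ∀ t ∈ Set.Icc (0 : ℝ) T, c * Real.exp (μ * t) * Φ t ^ (1 + q) ≤ Φ' t) :
    q * c * ((Real.exp (μ * T) - 1) / μ) * Φ 0 ^ q ≤ 1 := by
  have hG : ∀ t ∈ Set.Icc (0 : ℝ) T,
      HasDerivAt (fun s => -(Φ s ^ (-q)) - q * c * (Real.exp (μ * s) / μ))
        (-(Φ' t * (-q) * Φ t ^ (-q - 1)) - q * c * (Real.exp (μ * t) * (μ * 1) / μ)) t := by
    intro t ht
    exact ((hderiv t ht).rpow_const (Or.inl (hpos t ht).ne')).neg.sub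
      (((((hasDerivAt_id t).const_mul μ).exp).div_const μ).const_mul (q * c))
  have hmono : MonotoneOn (fun s => -(Φ s ^ (-q)) - q * c * (Real.exp (μ * s) / μ))
      (Set.Icc 0 T) := by
    refine monotoneOn_of_hasDerivWithinAt_nonneg (convex_Icc 0 T)
      (fun t ht => (hG t ht).continuousAt.continuousWithinAt)
      (fun t ht => (hG t (interior_subset ht)).hasDerivWithinAt) fun t ht => ?_
    have ht' := interior_subset ht
    have hΦ := hpos t ht'
    have hmul : Φ t ^ (1 + q) * Φ t ^ (-q - 1) = 1 := by
      rw [← Real.rpow_add hΦ]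
      ring_nf
      exact Real.rpow_zero _
    have h := mul_le_mul_of_nonneg_right (hineq t ht') (Real.rpow_pos_of_pos hΦ (-q - 1)).le
    rw [mul_assoc, hmul, mul_one] at h
    have h2 := mul_le_mul_of_nonneg_left h hq.le
    rw [mul_one, mul_div_cancel_right₀ _ hμ.ne']
    linarith
  have h0 : (0 : ℝ) ∈ Set.Icc 0 T := Set.left_mem_Icc.2 hT.le
  have hT' : T ∈ Set.Icc 0 T := Set.right_mem_Icc.2 hT.le
  have hle := hmono h0 hT' hT.le
  simp only [mul_zero, Real.exp_zero] at hle
  have hΦT := Real.rpow_pos_of_pos (hpos T hT') (-q)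
  have hle' : q * c * ((Real.exp (μ * T) - 1) / μ) ≤ Φ 0 ^ (-q) := by
    rw [sub_div, mul_sub]
    linarith
  have hΦ0 := hpos 0 h0
  calc q * c * ((Real.exp (μ * T) - 1) / μ) * Φ 0 ^ q
      ≤ Φ 0 ^ (-q) * Φ 0 ^ q := by gcongr
    _ = 1 := by rw [← Real.rpow_add hΦ0, neg_add_cancel, Real.rpow_zero]


/-- Inequality (5.1) in the blow-up proof: if `Φ > 0` on `[0,T]` and
`Φ' ≥ e^{μt}·Φ·(e^{βΦ^p} − 1)` on `[0,T]`, then for every `k ≥ 1`,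
`(p β^k/(k−1)!)·((e^{μT} − 1)/μ)·Φ(0)^{pk} ≤ 1`. -/
theorem blowup_factorial_bound (p β μ T : ℝ) (hp : 0 < p) (hβ : 0 < β)
    (hμ : 0 < μ) (hT : 0 < T) (Φ Φ' : ℝ → ℝ)
    (hderiv : ∀ t ∈ Set.Icc (0 : ℝ) T, HasDerivAt Φ (Φ' t) t)
    (hpos : ∀ t ∈ Set.Icc (0 : ℝ) T, 0 < Φ t)
    (hineq : ∀ t ∈ Set.Icc (0 : ℝ) T,
      Real.exp (μ * t) * Φ t * (Real.exp (β * Φ t ^ (p : ℝ)) - 1) ≤ Φ' t) :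
    ∀ k : ℕ, 1 ≤ k →
      (p * β ^ k / (Nat.factorial (k - 1) : ℝ)) * ((Real.exp (μ * T) - 1) / μ)
          * Φ 0 ^ (p * (k : ℝ)) ≤ 1 := by
  intro k hk
  have hk0 : (0 : ℝ) < k := by exact_mod_cast hk
  have hbound := mul_rpow_le_one_of_exp_mul_rpow_le_deriv (c := β ^ k / (Nat.factorial k : ℝ))
    (mul_pos hp hk0) hμ hT hderiv hpos fun t ht => by
      have hΦ := hpos t ht
      have hexp := Real.pow_div_factorial_le_exp_sub_one
        (x := β * Φ t ^ p) (by positivity) hk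
      rw [mul_pow, ← Real.rpow_mul_natCast hΦ.le] at hexp
      refine le_trans ?_ (hineq t ht)
      calc β ^ k / (Nat.factorial k : ℝ) * Real.exp (μ * t) * Φ t ^ (1 + p * (k : ℝ))
          = Real.exp (μ * t) * Φ t * (β ^ k * Φ t ^ (p * (k : ℝ)) / (Nat.factorial k : ℝ)) := by
            rw [Real.rpow_add hΦ, Real.rpow_one]
            ring
        _ ≤ _ := by gcongr
  have hfac : (Nat.factorial k : ℝ) = k * (Nat.factorial (k - 1) : ℝ) := by
    exact_mod_cast (Nat.mul_factorial_pred (by omega)).symm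
  have hcoef : p * (k : ℝ) * (β ^ k / (Nat.factorial k : ℝ))
      = p * β ^ k / (Nat.factorial (k - 1) : ℝ) := by
    rw [hfac]
    field_simp
  rwa [hcoef] at hbound
end

section
/- Let p, β, μ, T > 0 be real numbers and let Φ : ℝ → ℝ be differentiable on [0, T] with Φ(t) > 0 for all t ∈ [0, T], and suppose that Φ'(t) ≥ exp(μt)·Φ(t)·(exp(β·Φ(t)^p) − 1) for all t ∈ [0, T]. Then (p·β/2)·Φ(0)^p·((exp(μT) − 1)/μ) ≤ 1. -/
/-- If `Φ > 0` and `β e^{μt} Φ^{p+1} ≤ Φ'`, then `Φ^{-p} + (pβ/μ) e^{μt}` is nonincreasing. -/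
theorem antitoneOn_rpow_neg_add_exp {p β μ T : ℝ} (hp : 0 < p) (hμ : μ ≠ 0) {Φ Φ' : ℝ → ℝ}
    (hderiv : ∀ t ∈ Set.Icc (0 : ℝ) T, HasDerivAt Φ (Φ' t) t)
    (hpos : ∀ t ∈ Set.Icc (0 : ℝ) T, 0 < Φ t)
    (hineq : ∀ t ∈ Set.Icc (0 : ℝ) T, β * Real.exp (μ * t) * Φ t ^ (p + 1) ≤ Φ' t) :
    AntitoneOn (fun t => Φ t ^ (-p) + p * β / μ * Real.exp (μ * t)) (Set.Icc 0 T) := by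
  have hd : ∀ t ∈ Set.Icc (0 : ℝ) T,
      HasDerivAt (fun t => Φ t ^ (-p) + p * β / μ * Real.exp (μ * t))
        (Φ' t * (-p) * Φ t ^ (-p - 1) + p * β / μ * (Real.exp (μ * t) * (μ * 1))) t :=
    fun t ht => ((hderiv t ht).rpow_const (Or.inl (hpos t ht).ne')).add
      ((((hasDerivAt_id t).const_mul μ).exp).const_mul (p * β / μ))
  refine antitoneOn_of_hasDerivWithinAt_nonpos (convex_Icc 0 T)
    (fun t ht => (hd t ht).continuousAt.continuousWithinAt)
    (fun t ht => (hd t (interior_subset ht)).hasDerivWithinAt) fun t ht => ?_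
  replace ht := interior_subset ht
  have hΦ := hpos t ht
  have hcancel : Φ t ^ (p + 1) * Φ t ^ (-p - 1) = 1 := by
    rw [← Real.rpow_add hΦ]
    ring_nf
    exact Real.rpow_zero _
  have hmul := mul_le_mul_of_nonneg_right (hineq t ht) (Real.rpow_nonneg hΦ.le (-p - 1))
  rw [mul_assoc, hcancel, mul_one] at hmul
  have hexp : p * β / μ * (Real.exp (μ * t) * (μ * 1)) = p * (β * Real.exp (μ * t)) := by
    field_simp
  rw [hexp]
  linarith [mul_le_mul_of_nonneg_left hmul hp.le]


/-- Quantitative blow-up inequality: if `Φ > 0` on `[0,T]` and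
`Φ' ≥ e^{μt}·Φ·(e^{βΦ^p} − 1)` on `[0,T]`, then
`(pβ/2)·Φ(0)^p·((e^{μT} − 1)/μ) ≤ 1`. -/
theorem blowup_quantitative_bound (p β μ T : ℝ) (hp : 0 < p) (hβ : 0 < β)
    (hμ : 0 < μ) (hT : 0 < T) (Φ Φ' : ℝ → ℝ)
    (hderiv : ∀ t ∈ Set.Icc (0 : ℝ) T, HasDerivAt Φ (Φ' t) t)
    (hpos : ∀ t ∈ Set.Icc (0 : ℝ) T, 0 < Φ t)
    (hineq : ∀ t ∈ Set.Icc (0 : ℝ) T,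
      Real.exp (μ * t) * Φ t * (Real.exp (β * Φ t ^ (p : ℝ)) - 1) ≤ Φ' t) :
    (p * β / 2) * Φ 0 ^ (p : ℝ) * ((Real.exp (μ * T) - 1) / μ) ≤ 1 := by
  have h0 : (0 : ℝ) ∈ Set.Icc 0 T := ⟨le_rfl, hT.le⟩
  have hT' : T ∈ Set.Icc (0 : ℝ) T := ⟨hT.le, le_rfl⟩
  have hanti := antitoneOn_rpow_neg_add_exp (β := β) hp hμ.ne' hderiv hpos
    (fun t ht => by
      refine le_trans ?_ (hineq t ht)
      have hΦ := hpos t ht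
      rw [Real.rpow_add_one hΦ.ne']
      have hexp : β * Φ t ^ p ≤ Real.exp (β * Φ t ^ p) - 1 := by
        linarith [Real.add_one_le_exp (β * Φ t ^ p)]
      calc β * Real.exp (μ * t) * (Φ t ^ p * Φ t)
          = Real.exp (μ * t) * Φ t * (β * Φ t ^ p) := by ring
        _ ≤ _ := by gcongr) h0 hT' hT.le
  simp only [mul_zero, Real.exp_zero, mul_one] at hanti
  have hmain : p * β * ((Real.exp (μ * T) - 1) / μ) ≤ Φ 0 ^ (-p) := by
    have hTpos := Real.rpow_pos_of_pos (hpos T hT') (-p)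
    have hsplit : p * β * ((Real.exp (μ * T) - 1) / μ)
        = p * β / μ * Real.exp (μ * T) - p * β / μ := by ring
    linarith
  have hΦ0 := Real.rpow_pos_of_pos (hpos 0 h0) p
  have hmul := mul_le_mul_of_nonneg_left hmain hΦ0.le
  rw [Real.rpow_neg (hpos 0 h0).le, mul_inv_cancel₀ hΦ0.ne'] at hmul
  linarith
end

section
/- Let q ≥ 0 and T > 0 be real numbers, let g : ℝ → ℝ be continuous with g(s) > 0 for all s > 0, and let Φ : ℝ → ℝ be differentiable on [0, T] with Φ(t) > 0 for all t ∈ [0, T] and Φ'(t) ≥ t^q·g(Φ(t)) for all t ∈ [0, T]. Then ∫_{Φ(0)}^{Φ(T)} dτ/g(τ) ≥ T^{q+1}/(q+1). -/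
open intervalIntegral

/-- Change-of-variables comparison: if `g` is continuous and positive on `(0,∞)`,
`Φ > 0` on `[0,T]` and `Φ'(t) ≥ t^q·g(Φ(t))` on `[0,T]`, then
`∫_{Φ(0)}^{Φ(T)} dτ/g(τ) ≥ T^{q+1}/(q+1)`. -/
theorem ode_comparison (q T : ℝ) (hq : 0 ≤ q) (hT : 0 < T) (g : ℝ → ℝ)
    (hg : Continuous g) (hgpos : ∀ s : ℝ, 0 < s → 0 < g s) (Φ Φ' : ℝ → ℝ)
    (hderiv : ∀ t ∈ Set.Icc (0 : ℝ) T, HasDerivAt Φ (Φ' t) t)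
    (hpos : ∀ t ∈ Set.Icc (0 : ℝ) T, 0 < Φ t)
    (hineq : ∀ t ∈ Set.Icc (0 : ℝ) T, t ^ (q : ℝ) * g (Φ t) ≤ Φ' t) :
    T ^ (q + 1 : ℝ) / (q + 1) ≤ ∫ τ in (Φ 0)..(Φ T), 1 / g τ := by
  have hq1 : 0 < q + 1 := by linarith
  have h0 : (0 : ℝ) ∈ Set.Icc 0 T := Set.left_mem_Icc.2 hT.le
  have hF : ∀ t ∈ Set.Icc (0 : ℝ) T,
      HasDerivAt (fun t => ∫ τ in (Φ 0)..(Φ t), 1 / g τ) (1 / g (Φ t) * Φ' t) t := by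
    intro t ht
    have hcont : ∀ s : ℝ, 0 < s → ContinuousAt (fun τ => 1 / g τ) s := fun s hs =>
      continuousAt_const.div hg.continuousAt (hgpos s hs).ne'
    have hint : IntervalIntegrable (fun τ => 1 / g τ) MeasureTheory.volume (Φ 0) (Φ t) :=
      ContinuousOn.intervalIntegrable fun s hs =>
        (hcont s ((lt_min (hpos 0 h0) (hpos t ht)).trans_le hs.1)).continuousWithinAt
    have hmeas : Measurable fun τ => 1 / g τ := hg.measurable.const_div 1
    exact (integral_hasDerivAt_right hint hmeas.stronglyMeasurable.stronglyMeasurableAtFilter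
      (hcont _ (hpos t ht))).comp t (hderiv t ht)
  have hP : ∀ t : ℝ, HasDerivAt (fun t : ℝ => t ^ (q + 1) / (q + 1)) (t ^ q) t := by
    intro t
    have h := (Real.hasDerivAt_rpow_const (x := t) (p := q + 1)
      (Or.inr (by linarith))).div_const (q + 1)
    rwa [add_sub_cancel_right, mul_div_cancel_left₀ _ hq1.ne'] at h
  refine image_le_of_deriv_right_le_deriv_boundary
    (fun t _ => (hP t).continuousAt.continuousWithinAt) (fun t _ => (hP t).hasDerivWithinAt)
    (by simp [Real.zero_rpow hq1.ne'])
    (fun t ht => (hF t ht).continuousAt.continuousWithinAt)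
    (fun t ht => (hF t (Set.Ico_subset_Icc_self ht)).hasDerivWithinAt) (fun t ht => ?_)
    (Set.right_mem_Icc.2 hT.le)
  have ht' := Set.Ico_subset_Icc_self ht
  rw [one_div_mul_eq_div, le_div_iff₀ (hgpos _ (hpos t ht'))]
  exact hineq t ht'
end

section
/- Let α > 0, κ > 0, q > 0 and T > 0 be real numbers, and let g : ℝ → ℝ be continuous with g(s) = s·(log(1/s))^{−α} for 0 < s ≤ 1/2 and g(s) ≥ κ·s² > 0 for s ≥ 1/2. Let Φ : ℝ → ℝ be differentiable on [0, T] with Φ(t) > 0 for all t ∈ [0, T], Φ(0) ≤ 1/2, and Φ'(t) ≥ t^q·g(Φ(t)) for all t ∈ [0, T]. Then T^{q+1}/(q+1) ≤ (log(1/Φ(0)))^{α+1}/(α+1) + 2/κ. -/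
/-- A function whose derivative dominates `t ^ q` on `[a, b]` grows at least as fast as
the primitive `t ^ (q + 1) / (q + 1)`. -/
lemma rpow_div_sub_le_of_rpow_le_deriv {q a b : ℝ} (hq : 0 < q) (hab : a ≤ b)
    {F f : ℝ → ℝ} (hF : ∀ t ∈ Set.Icc a b, HasDerivAt F (f t) t)
    (hf : ∀ t ∈ Set.Icc a b, t ^ q ≤ f t) :
    b ^ (q + 1) / (q + 1) - a ^ (q + 1) / (q + 1) ≤ F b - F a := by
  have hd : ∀ t ∈ Set.Icc a b,
      HasDerivAt (fun t => F t - t ^ (q + 1) / (q + 1)) (f t - t ^ q) t := by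
    intro t ht
    have h := (Real.hasDerivAt_rpow_const (x := t) (p := q + 1)
      (Or.inr (by linarith))).div_const (q + 1)
    refine (hF t ht).sub (h.congr_deriv ?_)
    rw [add_sub_cancel_right]
    field_simp
  have hm : MonotoneOn (fun t => F t - t ^ (q + 1) / (q + 1)) (Set.Icc a b) := by
    refine monotoneOn_of_hasDerivWithinAt_nonneg (convex_Icc a b)
      (fun t ht => (hd t ht).continuousAt.continuousWithinAt)
      (fun t ht => (hd t (interior_subset ht)).hasDerivWithinAt)
      (fun t ht => sub_nonneg.2 (hf t (interior_subset ht)))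
  have := hm (Set.left_mem_Icc.2 hab) (Set.right_mem_Icc.2 hab) hab
  dsimp only at this
  linarith

/-- Analytic core of the type-I blow-up proof: if `g` is continuous with
`g(s) = s·(log(1/s))^{−α}` on `(0, 1/2]` and `g(s) ≥ κ s² > 0` for `s ≥ 1/2`,
and `Φ > 0` on `[0,T]` satisfies `Φ(0) ≤ 1/2` and `Φ'(t) ≥ t^q·g(Φ(t))` on
`[0,T]`, then `T^{q+1}/(q+1) ≤ (log(1/Φ(0)))^{α+1}/(α+1) + 2/κ`. -/
theorem type_I_blowup_core (α κ q T : ℝ) (hα : 0 < α) (hκ : 0 < κ)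
    (hq : 0 < q) (hT : 0 < T) (g : ℝ → ℝ) (hg : Continuous g)
    (hg1 : ∀ s : ℝ, 0 < s → s ≤ 1 / 2 → g s = s * (Real.log (1 / s)) ^ (-α : ℝ))
    (hg2 : ∀ s : ℝ, 1 / 2 ≤ s → κ * s ^ 2 ≤ g s ∧ 0 < κ * s ^ 2)
    (Φ Φ' : ℝ → ℝ)
    (hderiv : ∀ t ∈ Set.Icc (0 : ℝ) T, HasDerivAt Φ (Φ' t) t)
    (hpos : ∀ t ∈ Set.Icc (0 : ℝ) T, 0 < Φ t) (hΦ0 : Φ 0 ≤ 1 / 2)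
    (hineq : ∀ t ∈ Set.Icc (0 : ℝ) T, t ^ (q : ℝ) * g (Φ t) ≤ Φ' t) :
    T ^ (q + 1 : ℝ) / (q + 1)
      ≤ (Real.log (1 / Φ 0)) ^ (α + 1 : ℝ) / (α + 1) + 2 / κ := by
  have hgpos : ∀ s : ℝ, 0 < s → 0 ≤ g s := by
    intro s hs
    rcases le_total s (1 / 2) with h | h
    · rw [hg1 s hs h]
      exact mul_nonneg hs.le (Real.rpow_nonneg
        (Real.log_nonneg (by rw [le_div_iff₀ hs]; linarith)) _)
    · exact (hg2 s h).2.le.trans (hg2 s h).1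
  have hmono : MonotoneOn Φ (Set.Icc 0 T) :=
    monotoneOn_of_hasDerivWithinAt_nonneg (convex_Icc 0 T)
      (fun t ht => (hderiv t ht).continuousAt.continuousWithinAt)
      (fun t ht => (hderiv t (interior_subset ht)).hasDerivWithinAt)
      (fun t ht => (mul_nonneg (Real.rpow_nonneg (interior_subset ht).1 q)
        (hgpos _ (hpos t (interior_subset ht)))).trans (hineq t (interior_subset ht)))
  have hsmall : ∀ c ∈ Set.Icc (0 : ℝ) T, Φ c ≤ 1 / 2 →
      c ^ (q + 1) / (q + 1) ≤ (Real.log (1 / Φ 0)) ^ (α + 1) / (α + 1) := by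
    intro c hc hΦc
    have hsub : ∀ t ∈ Set.Icc 0 c, t ∈ Set.Icc 0 T := fun t ht => ⟨ht.1, ht.2.trans hc.2⟩
    have hle : ∀ t ∈ Set.Icc 0 c, Φ t ≤ 1 / 2 :=
      fun t ht => (hmono (hsub t ht) hc ht.2).trans hΦc
    have hlog : ∀ t ∈ Set.Icc 0 c, 0 < -Real.log (Φ t) := fun t ht =>
      neg_pos.2 (Real.log_neg (hpos t (hsub t ht)) (by linarith [hle t ht]))
    have key := rpow_div_sub_le_of_rpow_le_deriv hq hc.1
      (F := fun t => -((-Real.log (Φ t)) ^ (α + 1) / (α + 1)))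
      (f := fun t => Φ' t / Φ t * (-Real.log (Φ t)) ^ α) ?_ ?_
    · have h1 : 0 ≤ (-Real.log (Φ c)) ^ (α + 1) / (α + 1) :=
        div_nonneg (Real.rpow_nonneg (hlog c ⟨hc.1, le_rfl⟩).le _) (by linarith)
      rw [Real.zero_rpow (by linarith), zero_div] at key
      rw [one_div, Real.log_inv]
      linarith
    · intro t ht
      have hΦt := hpos t (hsub t ht)
      have h := ((((hderiv t (hsub t ht)).log hΦt.ne').neg.rpow_const (p := α + 1)
        (Or.inr (by linarith))).div_const (α + 1)).neg
      refine h.congr_deriv ?_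
      rw [add_sub_cancel_right]
      simp only [Pi.neg_apply]
      field_simp
    · intro t ht
      have hΦt := hpos t (hsub t ht)
      have h := hineq t (hsub t ht)
      rw [hg1 _ hΦt (hle t ht), one_div, Real.log_inv, Real.rpow_neg (hlog t ht).le] at h
      have hL : 0 < (-Real.log (Φ t)) ^ α := Real.rpow_pos_of_pos (hlog t ht) α
      calc t ^ q = t ^ q * (Φ t * ((-Real.log (Φ t)) ^ α)⁻¹) / Φ t
            * (-Real.log (Φ t)) ^ α := by field_simp
        _ ≤ Φ' t / Φ t * (-Real.log (Φ t)) ^ α := by gcongr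
  have h0 : (0 : ℝ) ∈ Set.Icc 0 T := ⟨le_rfl, hT.le⟩
  have hTm : T ∈ Set.Icc 0 T := ⟨hT.le, le_rfl⟩
  rcases le_total (Φ T) (1 / 2) with hΦT | hΦT
  · have := hsmall T hTm hΦT
    have : 0 < 2 / κ := by positivity
    linarith
  · obtain ⟨c, hc, hΦc⟩ := intermediate_value_Icc hT.le
      (fun t ht => (hderiv t ht).continuousAt.continuousWithinAt) ⟨hΦ0, hΦT⟩
    have hsub : ∀ t ∈ Set.Icc c T, t ∈ Set.Icc 0 T := fun t ht => ⟨hc.1.trans ht.1, ht.2⟩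
    have key := rpow_div_sub_le_of_rpow_le_deriv hq hc.2
      (F := fun t => -((Φ t)⁻¹ / κ)) (f := fun t => Φ' t / (κ * Φ t ^ 2)) ?_ ?_
    · have h1 := hsmall c hc hΦc.le
      have h2 : 0 < (Φ T)⁻¹ / κ := div_pos (inv_pos.2 (hpos T hTm)) hκ
      rw [hΦc, one_div, inv_inv] at key
      linarith
    · intro t ht
      have hΦt := hpos t (hsub t ht)
      refine (((hderiv t (hsub t ht)).inv hΦt.ne').div_const κ).neg.congr_deriv ?_
      field_simp
    · intro t ht
      have hge : 1 / 2 ≤ Φ t := hΦc.ge.trans (hmono hc (hsub t ht) ht.1)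
      obtain ⟨hg, hκΦ⟩ := hg2 _ hge
      rw [le_div_iff₀ hκΦ]
      exact (mul_le_mul_of_nonneg_left hg (Real.rpow_nonneg (hsub t ht).1 q)).trans
        (hineq t (hsub t ht))
end
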